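/- Let λ > −1/2 be real and let ν ≥ 0 be real. Then for every x ∈ (0,1], ʳG_ν^{(λ)}(x) = (Γ(λ+1/2) Γ(ν+1)/(2^ν Γ(ν+λ+1/2))) · Σ_{k=0}^∞ C(ν+λ−1/2, ν−k) · C(ν+λ−1/2, k) · (x−1)^k · (1+x)^{ν−k}, where C(a,b) := Γ(a+1)/(Γ(a−b+1) Γ(b+1)) is the generalized binomial coefficient, the series converging absolutely. -/

import Mathlib

open Real

/-- Pochhammer symbol `(a)_n = a (a+1) ⋯ (a+n-1)` for a real base. -/
noncomputable def poch (a : ℝ) (n : ℕ) : ℝ := ∏ i ∈ Finset.range n, (a + (i : ℝ))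

/-- The right generalized Gegenbauer function of fractional degree. -/
noncomputable def rG (lam nu x : ℝ) : ℝ :=
  ∑' j : ℕ, (poch (-nu) j * poch (nu + 2 * lam) j /
    ((j.factorial : ℝ) * poch (lam + 1 / 2) j)) * ((1 - x) / 2) ^ j

/-- Generalized binomial coefficient `C(a,b) = Γ(a+1)/(Γ(a−b+1) Γ(b+1))`. -/
noncomputable def gbinom (a b : ℝ) : ℝ :=
  Real.Gamma (a + 1) / (Real.Gamma (a - b + 1) * Real.Gamma (b + 1))

lemma poch_succ (a : ℝ) (n : ℕ) : poch a (n + 1) = poch a n * (a + n) := by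
  simp [poch, Finset.prod_range_succ]

lemma poch_zero (a : ℝ) : poch a 0 = 1 := by simp [poch]

lemma poch_succ_left (a : ℝ) (n : ℕ) : poch a (n + 1) = a * poch (a + 1) n := by
  simp only [poch, Finset.prod_range_succ']
  rw [mul_comm]
  congr 1
  · simp
  · refine Finset.prod_congr rfl fun i _ => ?_
    push_cast; ring

lemma poch_pos {a : ℝ} (ha : 0 < a) (n : ℕ) : 0 < poch a n :=
  Finset.prod_pos fun i _ => by positivity

lemma poch_add (a : ℝ) (k m : ℕ) : poch a (k + m) = poch a k * poch (a + k) m := by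
  simp only [poch, Finset.prod_range_add]
  congr 1
  refine Finset.prod_congr rfl fun i _ => ?_
  push_cast; ring

lemma abs_poch_le (a : ℝ) (k m : ℕ) : |poch (a + k) m| ≤ poch (|a| + k) m := by
  simp only [poch, Finset.abs_prod]
  refine Finset.prod_le_prod (fun i _ => abs_nonneg _) fun i _ => ?_
  have h1 := neg_abs_le a
  have h2 := le_abs_self a
  have h3 : (0:ℝ) ≤ k := k.cast_nonneg
  have h4 : (0:ℝ) ≤ i := i.cast_nonneg
  exact abs_le.2 ⟨by linarith, by linarith⟩

lemma chu (n : ℕ) : ∀ (c d : ℝ), 0 < c →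
    ∑ k ∈ Finset.range (n + 1), (-1) ^ k * (n.choose k : ℝ) * (poch d k / poch c k)
      = poch (c - d) n / poch c n := by
  induction n with
  | zero => intro c d hc; simp [poch_zero]
  | succ n ih =>
    intro c d hc
    have h1 := ih c d hc
    have h2 := ih (c + 1) (d + 1) (by linarith)
    have hA : ∑ k ∈ Finset.range (n + 1 + 1),
        (-1) ^ k * ((n + 1).choose k : ℝ) * (poch d k / poch c k)
        = ∑ k ∈ Finset.range (n + 1), (-1) ^ k * (n.choose k : ℝ) * (poch d k / poch c k)
          - d / c * ∑ k ∈ Finset.range (n + 1),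
            (-1) ^ k * (n.choose k : ℝ) * (poch (d + 1) k / poch (c + 1) k) := by
      have e : ∑ k ∈ Finset.range (n + 1), (-1) ^ k * (n.choose k : ℝ) * (poch d k / poch c k)
          = ∑ k ∈ Finset.range (n + 1 + 1),
            (-1) ^ k * (n.choose k : ℝ) * (poch d k / poch c k) := by
        rw [Finset.sum_range_succ _ (n + 1)]; simp
      rw [e, Finset.sum_range_succ', Finset.sum_range_succ' _ (n + 1), Finset.mul_sum]
      simp only [Nat.choose_zero_right]
      rw [add_sub_right_comm, ← Finset.sum_sub_distrib]
      congr 1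
      refine Finset.sum_congr rfl fun k _ => ?_
      rw [Nat.choose_succ_succ, poch_succ_left, poch_succ_left]
      have := (poch_pos (show 0 < c + 1 by linarith) k).ne'
      push_cast
      field_simp
      ring
    rw [hA, h1, h2, show c + 1 - (d + 1) = c - d by ring]
    have p1 := (poch_pos (show 0 < c + 1 by linarith) n).ne'
    have p2 := (poch_pos hc n).ne'
    have h3 : c * poch (c + 1) n = poch c n * (c + n) := by
      rw [← poch_succ_left, poch_succ]
    have h4 : 0 < c + n := by positivity
    have h5 : poch (c + 1) n = poch c n * (c + n) / c := by
      field_simp; linarith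
    rw [h5, poch_succ, poch_succ]
    field_simp
    ring

lemma binom_hasSum (a z : ℝ) (h0 : 0 ≤ z) (h1 : z < 1) :
    HasSum (fun m : ℕ => poch a m / m.factorial * z ^ m) ((1 - z) ^ (-a)) := by
  have h := (Real.one_div_one_sub_rpow_hasFPowerSeriesOnBall_zero a).hasSum (y := z)
    (by simp [enorm_eq_nnnorm, ← NNReal.coe_lt_coe, abs_of_nonneg h0, h1])
  have e : (1 - z) ^ (-a) = 1 / (1 - (0 + z)) ^ a := by
    rw [Real.rpow_neg (by linarith)]; simp
  rw [e]
  refine Eq.mp (congrArg (fun f => HasSum f _) (funext fun m => ?_)) h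
  symm
  have hm : poch a m = m.factorial * Ring.multichoose a m := by
    have := Ring.factorial_nsmul_multichoose_eq_ascPochhammer a m
    rw [nsmul_eq_mul] at this
    rw [this]
    clear this h e
    induction m with
    | zero => simp [poch_zero]
    | succ m ih =>
      rw [poch_succ, ih, ascPochhammer_succ_right, Polynomial.smeval_mul]
      simp [Polynomial.smeval_add, Polynomial.smeval_natCast]
  have hf : (m.factorial : ℝ) ≠ 0 := by positivity
  rw [hm]
  simp [Ring.choose]
  field_simp
  rw [show a + (m:ℝ) - 1 - m + 1 = a by ring, mul_comm]

/-- coefficients of a hypergeometric series -/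
noncomputable def hyp (a b c : ℝ) (k : ℕ) : ℝ :=
  poch a k * poch b k / ((k.factorial : ℝ) * poch c k)

lemma hyp_summable (a b c w : ℝ) (hc : 0 < c) (h1 : |w| < 1) :
    Summable (fun k => hyp a b c k * w ^ k) := by
  obtain ⟨r, hr, hr1⟩ := exists_between h1
  refine summable_of_ratio_norm_eventually_le hr1 ?_
  have lim : Filter.Tendsto (fun k : ℕ => |(a + k) / (k + 1) * ((b + k) / (k + c)) * w|)
      Filter.atTop (nhds |1 * 1 * w|) := by
    have aux : ∀ p q : ℝ, Filter.Tendsto (fun k : ℕ => (p + k) / (k + q))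
        Filter.atTop (nhds 1) := by
      intro p q
      have := tendsto_add_mul_div_add_mul_atTop_nhds p q (1:ℝ) (d := 1) one_ne_zero
      simpa [add_comm] using this
    exact (((aux a 1).mul (aux b c)).mul_const w).abs
  rw [one_mul, one_mul] at lim
  filter_upwards [lim.eventually_le_const hr] with k hk
  have e : hyp a b c (k + 1) * w ^ (k + 1) =
      ((a + k) / (k + 1) * ((b + k) / (k + c)) * w) * (hyp a b c k * w ^ k) := by
    have := (poch_pos hc k).ne'
    have h2 : (k:ℝ) + c ≠ 0 := by positivity
    have h3 : c + (k:ℝ) ≠ 0 := by positivity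
    have hf : (k.factorial : ℝ) ≠ 0 := by positivity
    simp only [hyp, poch_succ, Nat.factorial_succ]
    push_cast
    rw [add_comm c]
    field_simp
    ring
  rw [e, norm_mul]
  exact mul_le_mul_of_nonneg_right hk (norm_nonneg _)

lemma pfaff (a b c z : ℝ) (hc : 0 < c) (h0 : 0 ≤ z) (h1 : z < 1 / 2) :
    Summable (fun k : ℕ => hyp a (c - b) c k * (-z) ^ k * (1 - z) ^ (-a - k)) ∧
    ∑' j : ℕ, hyp a b c j * z ^ j =
      ∑' k : ℕ, hyp a (c - b) c k * (-z) ^ k * (1 - z) ^ (-a - k) := by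
  have hz : 0 < 1 - z := by linarith
  set F : ℕ × ℕ → ℝ := fun p => hyp a (c - b) c p.1 * (-z) ^ p.1 *
    (poch (a + p.1) p.2 / p.2.factorial * z ^ p.2) with hF
  set G : ℕ × ℕ → ℝ := fun p => |hyp a (c - b) c p.1| * z ^ p.1 *
    (poch (|a| + p.1) p.2 / p.2.factorial * z ^ p.2) with hG
  have hpn : ∀ k m : ℕ, 0 ≤ poch (|a| + k) m := fun k m =>
    (abs_nonneg _).trans (abs_poch_le a k m)
  have hGn : 0 ≤ G := fun p => by
    have := hpn p.1 p.2
    simp only [hG, Pi.zero_apply]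
    positivity
  have hGs : ∀ k : ℕ, HasSum (fun m => G (k, m))
      (|hyp a (c - b) c k| * z ^ k * (1 - z) ^ (-(|a| + k))) := fun k =>
    (binom_hasSum (|a| + k) z h0 (by linarith)).mul_left _
  have hG' : Summable G := by
    rw [summable_prod_of_nonneg hGn]
    refine ⟨fun k => (hGs k).summable, ?_⟩
    simp only [fun k => (hGs k).tsum_eq]
    have hw : |z / (1 - z)| < 1 := by
      rw [abs_of_nonneg (by positivity), div_lt_one hz]; linarith
    have := ((hyp_summable a (c - b) c _ hc hw).abs).mul_left ((1 - z) ^ (-|a|))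
    refine this.congr fun k => ?_
    rw [neg_add, Real.rpow_add hz, Real.rpow_neg hz.le (k : ℝ), Real.rpow_natCast, abs_mul,
      abs_pow, abs_of_nonneg (show 0 ≤ z / (1 - z) by positivity), div_pow]
    field_simp
  have hF' : Summable F := by
    refine Summable.of_norm_bounded hG' fun p => ?_
    simp only [hF, hG, Real.norm_eq_abs, abs_mul, abs_div, abs_pow, abs_neg, abs_of_nonneg h0,
      Nat.abs_cast]
    gcongr
    exact abs_poch_le a p.1 p.2
  have hFs : ∀ k : ℕ, HasSum (fun m => F (k, m))
      (hyp a (c - b) c k * (-z) ^ k * (1 - z) ^ (-a - k)) := fun k => by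
    have := (binom_hasSum (a + k) z h0 (by linarith)).mul_left (hyp a (c - b) c k * (-z) ^ k)
    rwa [show -(a + (k:ℝ)) = -a - k by ring] at this
  have key := hF'.hasSum.prod_fiberwise hFs
  refine ⟨key.summable, ?_⟩
  rw [key.tsum_eq]
  have h3 := (Finset.HasAntidiagonal.sigmaAntidiagonalEquivProd (A := ℕ)).hasSum_iff.2 hF'.hasSum
  have h4 := h3.sigma (fun n => hasSum_fintype _)
  rw [← h4.tsum_eq]
  refine tsum_congr fun n => ?_
  have h5 : ∑ p : Finset.HasAntidiagonal.antidiagonal n, (F ∘ (Finset.HasAntidiagonal.sigmaAntidiagonalEquivProd (A := ℕ))) ⟨n, p⟩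
      = ∑ p ∈ Finset.HasAntidiagonal.antidiagonal n, F p := by
    exact Finset.sum_coe_sort (Finset.HasAntidiagonal.antidiagonal n) F
  rw [h5, Finset.Nat.sum_antidiagonal_eq_sum_range_succ_mk]
  have h6 : hyp a b c n * z ^ n = poch a n / n.factorial * z ^ n *
      (poch (c - (c - b)) n / poch c n) := by
    simp only [hyp, sub_sub_cancel]
    have := (poch_pos hc n).ne'
    field_simp
  rw [h6, ← chu n c (c - b) hc, Finset.mul_sum]
  refine Finset.sum_congr rfl fun k hk => ?_
  obtain ⟨m, rfl⟩ := Nat.exists_eq_add_of_le (Nat.lt_succ_iff.1 (Finset.mem_range.1 hk))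
  have := (poch_pos hc k).ne'
  simp only [hF, hyp, Nat.add_sub_cancel_left, poch_add, Nat.cast_add_choose, neg_pow z, pow_add]
  have hf : ((k + m).factorial : ℝ) ≠ 0 := by positivity
  field_simp

lemma inv_gamma (u : ℝ) : (Real.Gamma u)⁻¹ = u * (Real.Gamma (u + 1))⁻¹ := by
  by_cases hu : u = 0
  · simp [hu, Real.Gamma_zero]
  · rw [Real.Gamma_add_one hu, mul_inv]
    field_simp

lemma gamma_down (s : ℝ) (hs : 0 < s + 1) (k : ℕ) :
    (Real.Gamma (s - k + 1))⁻¹ = (-1) ^ k * poch (-s) k * (Real.Gamma (s + 1))⁻¹ := by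
  induction k with
  | zero => simp [poch_zero]
  | succ k ih =>
    rw [show s - ((k + 1 : ℕ) : ℝ) + 1 = s - k by push_cast; ring, inv_gamma, ih, poch_succ]
    ring

lemma gamma_up (c : ℝ) (hc : 0 < c) (k : ℕ) :
    Real.Gamma (c + k) = poch c k * Real.Gamma c := by
  induction k with
  | zero => simp [poch_zero]
  | succ k ih =>
    rw [show c + ((k + 1 : ℕ) : ℝ) = c + k + 1 by push_cast; ring,
      Real.Gamma_add_one (by positivity), ih, poch_succ]
    ring

lemma term_eq (lam nu : ℝ) (hlam : -(1 / 2) < lam) (hnu : 0 ≤ nu)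
    (x : ℝ) (hx : x ∈ Set.Ioc (0 : ℝ) 1) (k : ℕ) :
    Real.Gamma (lam + 1 / 2) * Real.Gamma (nu + 1) /
          (2 ^ nu * Real.Gamma (nu + lam + 1 / 2)) *
      (gbinom (nu + lam - 1 / 2) (nu - k) * gbinom (nu + lam - 1 / 2) k *
        (x - 1) ^ k * (1 + x) ^ (nu - k)) =
    hyp (-nu) (lam + 1 / 2 - (nu + 2 * lam)) (lam + 1 / 2) k * (-((1 - x) / 2)) ^ k *
      (1 - (1 - x) / 2) ^ (-(-nu) - k) := by
  have hc : 0 < lam + 1 / 2 := by linarith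
  have hx0 : 0 < 1 + x := by linarith [hx.1]
  have g1 := (Real.Gamma_pos_of_pos hc).ne'
  have g2 := (Real.Gamma_pos_of_pos (show 0 < nu + 1 by linarith)).ne'
  have g3 := (Real.Gamma_pos_of_pos (show 0 < nu + lam + 1 / 2 by linarith)).ne'
  have p := (poch_pos hc k).ne'
  have d1 := gamma_down nu (by linarith) k
  have d2 := gamma_down (nu + lam - 1 / 2) (by linarith) k
  rw [show nu + lam - 1 / 2 + 1 = nu + lam + 1 / 2 by ring] at d2
  have hk : Real.Gamma ((k : ℝ) + 1) = k.factorial := Real.Gamma_nat_eq_factorial k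
  have e1 : gbinom (nu + lam - 1 / 2) (nu - k) = Real.Gamma (nu + lam + 1 / 2) *
      ((poch (lam + 1 / 2) k * Real.Gamma (lam + 1 / 2))⁻¹ *
        ((-1) ^ k * poch (-nu) k * (Real.Gamma (nu + 1))⁻¹)) := by
    rw [← gamma_up _ hc, ← d1, gbinom, div_eq_mul_inv, mul_inv]
    rw [show nu + lam - 1 / 2 + 1 = nu + lam + 1 / 2 by ring,
      show nu + lam - 1 / 2 - (nu - (k:ℝ)) + 1 = lam + 1 / 2 + k by ring]
  have e2 : gbinom (nu + lam - 1 / 2) k = Real.Gamma (nu + lam + 1 / 2) *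
      ((-1) ^ k * poch (-(nu + lam - 1 / 2)) k * (Real.Gamma (nu + lam + 1 / 2))⁻¹ *
        (k.factorial : ℝ)⁻¹) := by
    rw [← d2, gbinom, div_eq_mul_inv, mul_inv, hk]
    congr 2; ring
  have e3 : (1 - (1 - x) / 2) ^ (-(-nu) - (k:ℝ)) = (1 + x) ^ (nu - k) / (2 ^ nu / 2 ^ k) := by
    rw [show 1 - (1 - x) / 2 = (1 + x) / 2 by ring, neg_neg,
      Real.div_rpow hx0.le (by norm_num), Real.rpow_sub (by norm_num : (0:ℝ) < 2),
      Real.rpow_natCast]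
  have e4 : (-((1 - x) / 2)) ^ k = (x - 1) ^ k / 2 ^ k := by
    rw [← div_pow]; congr 1; ring
  have e5 : ((-1 : ℝ)) ^ k * (-1) ^ k = 1 := by
    rw [← mul_pow]; simp
  rw [e1, e2, e3, e4, hyp,
    show lam + 1 / 2 - (nu + 2 * lam) = -(nu + lam - 1 / 2) by ring]
  have h2 : (2:ℝ) ^ nu ≠ 0 := by positivity
  generalize (2:ℝ) ^ nu = T at *
  generalize (1 + x) ^ (nu - (k:ℝ)) = U at *
  generalize poch (-(nu + lam - 1 / 2)) k = P at *
  generalize poch (-nu) k = Q at *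
  generalize poch (lam + 1 / 2) k = R at *
  generalize Real.Gamma (nu + lam + 1 / 2) = X at *
  generalize Real.Gamma (lam + 1 / 2) = Y at *
  generalize Real.Gamma (nu + 1) = Z at *
  generalize (-1 : ℝ) ^ k = E at *
  generalize (x - 1) ^ k = V at *
  have hE : E ^ 2 = 1 := by rw [sq]; exact e5
  field_simp
  rw [hE]
  ring

/-- Series representation of the GGF-Fs in powers of `x − 1` and `1 + x`;
the series converges absolutely. -/
theorem ggf_series_representation (lam nu : ℝ) (hlam : -(1 / 2) < lam) (hnu : 0 ≤ nu)
    (x : ℝ) (hx : x ∈ Set.Ioc (0 : ℝ) 1) :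
    Summable (fun k : ℕ =>
      |gbinom (nu + lam - 1 / 2) (nu - k) * gbinom (nu + lam - 1 / 2) k *
        (x - 1) ^ k * (1 + x) ^ (nu - k)|) ∧
    rG lam nu x =
      Real.Gamma (lam + 1 / 2) * Real.Gamma (nu + 1) /
          (2 ^ nu * Real.Gamma (nu + lam + 1 / 2)) *
        ∑' k : ℕ, gbinom (nu + lam - 1 / 2) (nu - k) * gbinom (nu + lam - 1 / 2) k *
          (x - 1) ^ k * (1 + x) ^ (nu - k) := by
  have hc : 0 < lam + 1 / 2 := by linarith
  obtain ⟨hs, ht⟩ := pfaff (-nu) (nu + 2 * lam) (lam + 1 / 2) ((1 - x) / 2) hc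
    (by linarith [hx.2]) (by linarith [hx.1])
  simp only [← term_eq lam nu hlam hnu x hx] at hs ht
  have g1 := Real.Gamma_pos_of_pos hc
  have g2 := Real.Gamma_pos_of_pos (show 0 < nu + 1 by linarith)
  have g3 := Real.Gamma_pos_of_pos (show 0 < nu + lam + 1 / 2 by linarith)
  have hp : Real.Gamma (lam + 1 / 2) * Real.Gamma (nu + 1) /
          (2 ^ nu * Real.Gamma (nu + lam + 1 / 2)) ≠ 0 := by positivity
  refine ⟨((summable_mul_left_iff hp).1 hs).abs, ?_⟩
  rw [← tsum_mul_left, ← ht]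
  rfl
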